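/- Let n ≥ 1 and S, T ⊆ [n]. Define f₁(S) as the sequence listing the values 3(i−1)+2 for i ∉ S in ascending order, followed by the value 3n+1. Define g₁(T) = b₁b₂…b_{2n} by (b_{2i−1}, b_{2i}) = (3(i−1)+3, 3(i−1)+1) if i ∈ T and (b_{2i−1}, b_{2i}) = (3(i−1)+1, 3(i−1)+3) otherwise. Define f₂(S) as the sequence listing the values 3(i−1)+2 for i ∈ S in descending order. Then τ = f₁(S)g₁(T)f₂(S) is a permutation of [3n+1], and τ contains the pattern 4312 if and only if S ∩ T ≠ ∅. -/

import Mathlib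

/-- `Contains τ π`: the sequence `τ` contains the pattern `π`, i.e. some subsequence of `τ`
is order-isomorphic to `π`. -/
def Contains (τ π : List ℕ) : Prop :=
  ∃ f : Fin π.length → Fin τ.length, StrictMono f ∧
    ∀ j l : Fin π.length, (τ.get (f j) < τ.get (f l) ↔ π.get j < π.get l)

/-- The increasing pattern `1 2 … k`. -/
def IncPattern (k : ℕ) : List ℕ := List.range' 1 k

/-- The decreasing pattern `k (k-1) … 1`. -/
def DecPattern (k : ℕ) : List ℕ := (List.range' 1 k).reverse

/-- A pattern is a permutation of `[k] = {1,…,k}` where `k` is its length. -/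
def IsPattern (π : List ℕ) : Prop := π.Perm (List.range' 1 π.length)

/-- `τ` is a permutation of `[n] = {1,…,n}`. -/
def IsPermOf (n : ℕ) (τ : List ℕ) : Prop := τ.Perm (List.range' 1 n)

/-- `τ` is a sequence of pairwise distinct values from `[n]`. -/
def IsDistinctSeqIn (n : ℕ) (τ : List ℕ) : Prop :=
  τ.Nodup ∧ ∀ x ∈ τ, 1 ≤ x ∧ x ≤ n

/-- A deterministic single-pass streaming algorithm with state set `Q`:
initial state, accepting states, transition function. -/
structure StreamAlg (Q : Type) where
  q0 : Q
  F : Set Q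
  t : Q → ℕ → Q

/-- The state reached by the algorithm after reading the input `τ`. -/
def StreamAlg.run {Q : Type} (A : StreamAlg Q) (τ : List ℕ) : Q :=
  τ.foldl A.t A.q0

/-- The algorithm accepts the input `τ`. -/
def StreamAlg.Accepts {Q : Type} (A : StreamAlg Q) (τ : List ℕ) : Prop :=
  A.run τ ∈ A.F

/-- `A` solves `π`-PPM_n : it accepts a permutation `τ` of `[n]` iff `τ` contains `π`. -/
def SolvesPPM {Q : Type} (A : StreamAlg Q) (n : ℕ) (π : List ℕ) : Prop :=
  ∀ τ : List ℕ, IsPermOf n τ → (A.Accepts τ ↔ Contains τ π)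

/-- `A` solves `π`-SequencePPM_n : it accepts a sequence `τ` of pairwise distinct values
from `[n]` iff `τ` contains `π`. -/
def SolvesSeqPPM {Q : Type} (A : StreamAlg Q) (n : ℕ) (π : List ℕ) : Prop :=
  ∀ τ : List ℕ, IsDistinctSeqIn n τ → (A.Accepts τ ↔ Contains τ π)

/-- `f₁(S)`: the values `3(i−1)+2` for `i ∉ S` in ascending order, followed by `3n+1`. -/
def fOne (n : ℕ) (S : Finset ℕ) : List ℕ :=
  (((List.range' 1 n).filter (fun i => decide (i ∉ S))).map (fun i => 3 * (i - 1) + 2)) ++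
    [3 * n + 1]

/-- `g₁(T) = b₁…b_{2n}` with `(b_{2i−1}, b_{2i}) = (3(i−1)+3, 3(i−1)+1)` if `i ∈ T`, and the
two values swapped otherwise. -/
def gOne (n : ℕ) (T : Finset ℕ) : List ℕ :=
  (List.range' 1 n).flatMap (fun i =>
    if i ∈ T then [3 * (i - 1) + 3, 3 * (i - 1) + 1]
    else [3 * (i - 1) + 1, 3 * (i - 1) + 3])

/-- `f₂(S)`: the values `3(i−1)+2` for `i ∈ S` in descending order. -/
def fTwo (n : ℕ) (S : Finset ℕ) : List ℕ :=
  (((List.range' 1 n).filter (fun i => decide (i ∈ S))).reverse).map (fun i => 3 * (i - 1) + 2)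

theorem mem_fOne {n : ℕ} {S : Finset ℕ} {x : ℕ} :
    x ∈ fOne n S ↔ (∃ i, 1 ≤ i ∧ i ≤ n ∧ i ∉ S ∧ x + 1 = 3 * i) ∨ x = 3 * n + 1 := by
  simp only [fOne, List.mem_append, List.mem_map, List.mem_filter, List.mem_range'_1,
    List.mem_singleton, decide_eq_true_eq]
  refine or_congr (exists_congr fun i => ?_) Iff.rfl
  constructor
  · rintro ⟨⟨⟨h1, h2⟩, h3⟩, h4⟩
    exact ⟨h1, by omega, h3, by omega⟩
  · rintro ⟨h1, h2, h3, h4⟩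
    exact ⟨⟨⟨h1, by omega⟩, h3⟩, by omega⟩

theorem mem_fTwo {n : ℕ} {S : Finset ℕ} {x : ℕ} :
    x ∈ fTwo n S ↔ ∃ i, 1 ≤ i ∧ i ≤ n ∧ i ∈ S ∧ x + 1 = 3 * i := by
  simp only [fTwo, List.mem_map, List.mem_reverse, List.mem_filter, List.mem_range'_1,
    decide_eq_true_eq]
  refine exists_congr fun i => ?_
  constructor
  · rintro ⟨⟨⟨h1, h2⟩, h3⟩, h4⟩
    exact ⟨h1, by omega, h3, by omega⟩
  · rintro ⟨h1, h2, h3, h4⟩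
    exact ⟨⟨⟨h1, by omega⟩, h3⟩, by omega⟩

theorem mem_gOne_block {T : Finset ℕ} {i x : ℕ} (hi : 1 ≤ i) :
    (x ∈ if i ∈ T then [3 * (i - 1) + 3, 3 * (i - 1) + 1]
      else [3 * (i - 1) + 1, 3 * (i - 1) + 3]) ↔ x = 3 * i ∨ x + 2 = 3 * i := by
  split_ifs <;> simp only [List.mem_cons, List.not_mem_nil, or_false] <;> omega

theorem mem_gOne {n : ℕ} {T : Finset ℕ} {x : ℕ} :
    x ∈ gOne n T ↔ ∃ i, 1 ≤ i ∧ i ≤ n ∧ (x = 3 * i ∨ x + 2 = 3 * i) := by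
  simp only [gOne, List.mem_flatMap, List.mem_range'_1]
  refine exists_congr fun i => ?_
  constructor
  · rintro ⟨⟨h1, h2⟩, h3⟩
    exact ⟨h1, by omega, (mem_gOne_block h1).1 h3⟩
  · rintro ⟨h1, h2, h3⟩
    exact ⟨⟨h1, by omega⟩, (mem_gOne_block h1).2 h3⟩

theorem pairwise_fOne (n : ℕ) (S : Finset ℕ) : (fOne n S).Pairwise (· < ·) := by
  rw [fOne, List.pairwise_append]
  refine ⟨?_, List.pairwise_singleton _ _, ?_⟩
  · rw [List.pairwise_map]
    refine ((List.pairwise_lt_range' (s := 1) (n := n)).filter _).imp_of_mem ?_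
    intro a b ha hb hab
    have := List.mem_range'_1.1 (List.mem_of_mem_filter ha)
    omega
  · intro a ha b hb
    obtain ⟨i, hi, rfl⟩ := List.mem_map.1 ha
    have := List.mem_range'_1.1 (List.mem_of_mem_filter hi)
    rw [List.mem_singleton.1 hb]
    omega

theorem pairwise_fTwo (n : ℕ) (S : Finset ℕ) : (fTwo n S).Pairwise (· > ·) := by
  rw [fTwo, List.pairwise_map, List.pairwise_reverse]
  refine ((List.pairwise_lt_range' (s := 1) (n := n)).filter _).imp_of_mem ?_
  intro a b ha hb hab
  have := List.mem_range'_1.1 (List.mem_of_mem_filter ha)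
  omega

/-- The only descents between entries of `gOne n T` are those inside the blocks of `T`. -/
theorem pairwise_gOne (n : ℕ) (T : Finset ℕ) :
    (gOne n T).Pairwise fun x y => x < y ∨ ∃ i ∈ T, x = 3 * i ∧ y + 2 = 3 * i := by
  rw [gOne, List.pairwise_flatMap]
  constructor
  · intro i hi
    have := List.mem_range'_1.1 hi
    split_ifs with h
    · rw [List.pairwise_pair]
      exact Or.inr ⟨i, h, by omega, by omega⟩
    · rw [List.pairwise_pair]
      exact Or.inl (by omega)
  · refine (List.pairwise_lt_range' (s := 1) (n := n)).imp_of_mem ?_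
    intro a b ha hb hab x hx y hy
    rw [mem_gOne_block (List.mem_range'_1.1 ha).1] at hx
    rw [mem_gOne_block (List.mem_range'_1.1 hb).1] at hy
    omega

theorem nodup_fOne_gOne_fTwo (n : ℕ) (S T : Finset ℕ) :
    (fOne n S ++ gOne n T ++ fTwo n S).Nodup := by
  rw [List.nodup_append, List.nodup_append]
  refine ⟨⟨(pairwise_fOne n S).imp Nat.ne_of_lt, (pairwise_gOne n T).imp ?_, ?_⟩,
    (pairwise_fTwo n S).imp Nat.ne_of_gt, ?_⟩
  · rintro a b (h | ⟨i, -, h⟩) <;> omega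
  · intro a ha b hb
    obtain ⟨j, hj⟩ := mem_gOne.1 hb
    rcases mem_fOne.1 ha with ⟨i, hi⟩ | h <;> omega
  · intro a ha b hb hab
    subst hab
    obtain ⟨j, -, hjn, hjS, hj⟩ := mem_fTwo.1 hb
    rcases List.mem_append.1 ha with ha | ha
    · rcases mem_fOne.1 ha with ⟨i, -, -, hiS, hi⟩ | h
      · obtain rfl : i = j := by omega
        exact hiS hjS
      · omega
    · obtain ⟨i, hi⟩ := mem_gOne.1 ha
      omega

theorem isPermOf_fOne_gOne_fTwo (n : ℕ) (S T : Finset ℕ) :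
    IsPermOf (3 * n + 1) (fOne n S ++ gOne n T ++ fTwo n S) := by
  refine (List.perm_ext_iff_of_nodup (nodup_fOne_gOne_fTwo n S T) List.nodup_range').2
    fun x => ?_
  rw [List.mem_append, List.mem_append, mem_fOne, mem_gOne, mem_fTwo, List.mem_range'_1]
  constructor
  · rintro (((⟨i, hi⟩ | h) | ⟨i, hi⟩) | ⟨i, hi⟩) <;> omega
  · intro hx
    by_cases h : x = 3 * n + 1
    · exact Or.inl (Or.inl (Or.inr h))
    by_cases h2 : x % 3 = 2
    · by_cases hS : x / 3 + 1 ∈ S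
      · exact Or.inr ⟨x / 3 + 1, by omega, by omega, hS, by omega⟩
      · exact Or.inl (Or.inl (Or.inl ⟨x / 3 + 1, by omega, by omega, hS, by omega⟩))
    · exact Or.inl (Or.inr ⟨(x + 2) / 3, by omega, by omega, by omega⟩)

open scoped List in
theorem contains_4312_iff_sublist (τ : List ℕ) :
    Contains τ [4, 3, 1, 2] ↔ ∃ a b c d, [a, b, c, d] <+ τ ∧ c < d ∧ d < b ∧ b < a := by
  constructor
  · rintro ⟨f, hf, h⟩
    refine ⟨τ.get (f 0), τ.get (f 1), τ.get (f 2), τ.get (f 3), ?_,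
      (h 2 3).2 (by decide), (h 3 1).2 (by decide), (h 1 0).2 (by decide)⟩
    rw [List.sublist_iff_exists_fin_orderEmbedding_get_eq]
    refine ⟨OrderEmbedding.ofStrictMono f hf, fun i => ?_⟩
    change Fin 4 at i
    fin_cases i <;> rfl
  · rintro ⟨a, b, c, d, hs, h1, h2, h3⟩
    obtain ⟨f, hf⟩ := List.sublist_iff_exists_fin_orderEmbedding_get_eq.1 hs
    refine ⟨f, f.strictMono, fun j l => ?_⟩
    have key : ∀ j l : Fin 4, [a, b, c, d].get j < [a, b, c, d].get l ↔
        [4, 3, 1, 2].get j < [4, 3, 1, 2].get l := by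
      intro j l
      fin_cases j <;> fin_cases l <;> simp <;> omega
    have hj := hf j
    have hl := hf l
    rw [← hj, ← hl]
    exact key j l

open scoped List in
/-- If an increasing list, a list and a decreasing list are concatenated, then in every occurrence
of `4312` the entries playing `3` and `1` lie in the middle list, and the entry playing `2` does not
lie in the first one. -/
theorem mid_of_sublist_append {A G B : List ℕ} (hA : A.Pairwise (· < ·))
    (hB : B.Pairwise (· > ·)) {a b c d : ℕ} (h : [a, b, c, d] <+ A ++ G ++ B)
    (hcd : c < d) (hba : b < a) : [b, c] <+ G ∧ (d ∈ G ∨ d ∈ B) := by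
  rw [List.append_assoc] at h
  have hbcd : [b, c, d] <+ G ++ B := by
    obtain ⟨l₁, l₂, he, h₁, h₂⟩ := List.sublist_append_iff.1 h
    match l₁, he with
    | [], he =>
      rw [List.nil_append] at he
      exact (List.sublist_cons_self _ _).trans (he ▸ h₂)
    | [x], he =>
      obtain ⟨rfl, rfl⟩ := List.cons_eq_cons.1 he
      exact h₂
    | x :: y :: l, he =>
      simp only [List.cons_append, List.cons.injEq] at he
      obtain ⟨rfl, rfl, -⟩ := he
      have := List.rel_of_pairwise_cons (hA.sublist h₁) List.mem_cons_self
      omega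
  have hd : d ∈ G ∨ d ∈ B := List.mem_append.1 (hbcd.subset (by simp))
  refine ⟨?_, hd⟩
  obtain ⟨l₁, l₂, he, h₁, h₂⟩ := List.sublist_append_iff.1 hbcd
  have descending : ¬ [c, d] <+ B := fun hs => by
    have := List.rel_of_pairwise_cons (hB.sublist hs) List.mem_cons_self
    omega
  match l₁, he with
  | [], he =>
    rw [List.nil_append] at he
    exact absurd ((List.sublist_cons_self _ _).trans (he ▸ h₂)) descending
  | [x], he =>
    obtain ⟨rfl, rfl⟩ := List.cons_eq_cons.1 he
    exact absurd h₂ descending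
  | x :: y :: l, he =>
    simp only [List.cons_append, List.cons.injEq] at he
    obtain ⟨rfl, rfl, -⟩ := he
    exact (by simp : [b, c] <+ b :: c :: l).trans h₁

theorem inter_nonempty_of_contains {n : ℕ} {S T : Finset ℕ}
    (h : Contains (fOne n S ++ gOne n T ++ fTwo n S) [4, 3, 1, 2]) : (S ∩ T).Nonempty := by
  obtain ⟨a, b, c, d, hs, hcd, hdb, hba⟩ := (contains_4312_iff_sublist _).1 h
  obtain ⟨hG, hd⟩ := mid_of_sublist_append (pairwise_fOne n S) (pairwise_fTwo n S) hs hcd hba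
  rcases List.pairwise_pair.1 ((pairwise_gOne n T).sublist hG) with hbc | ⟨i, hiT, hb, hc⟩
  · omega
  rcases hd with hd | hd
  · obtain ⟨j, hj⟩ := mem_gOne.1 hd
    omega
  · obtain ⟨j, -, -, hjS, hj⟩ := mem_fTwo.1 hd
    obtain rfl : i = j := by omega
    exact ⟨i, Finset.mem_inter.2 ⟨hjS, hiT⟩⟩

open scoped List in
theorem contains_of_mem {n : ℕ} {S T : Finset ℕ} {i : ℕ} (hi : 1 ≤ i) (hin : i ≤ n)
    (hiS : i ∈ S) (hiT : i ∈ T) :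
    Contains (fOne n S ++ gOne n T ++ fTwo n S) [4, 3, 1, 2] := by
  refine (contains_4312_iff_sublist _).2 ⟨3 * n + 1, 3 * (i - 1) + 3, 3 * (i - 1) + 1,
    3 * (i - 1) + 2, ?_, by omega, by omega, by omega⟩
  have hG : [3 * (i - 1) + 3, 3 * (i - 1) + 1] <+ gOne n T := by
    have := List.sublist_flatten_of_mem (List.mem_map_of_mem (f := fun i =>
      if i ∈ T then [3 * (i - 1) + 3, 3 * (i - 1) + 1]
      else [3 * (i - 1) + 1, 3 * (i - 1) + 3])
      (List.mem_range'_1.2 ⟨hi, by omega⟩ : i ∈ List.range' 1 n))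
    rwa [if_pos hiT, ← List.flatMap_def] at this
  exact ((List.singleton_sublist.2 (mem_fOne.2 (Or.inr rfl))).append hG).append
    (List.singleton_sublist.2 (mem_fTwo.2 ⟨i, hi, hin, hiS, by omega⟩))


/-- For `n ≥ 1` and `S, T ⊆ [n]`, the sequence `τ = f₁(S)g₁(T)f₂(S)` is a
permutation of `[3n+1]`, and `τ` contains the pattern 4312 iff `S ∩ T ≠ ∅`. -/
theorem stmt13 (n : ℕ) (hn : 1 ≤ n) (S T : Finset ℕ)
    (hS : S ⊆ Finset.Icc 1 n) (hT : T ⊆ Finset.Icc 1 n) :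
    IsPermOf (3 * n + 1) (fOne n S ++ gOne n T ++ fTwo n S) ∧
    (Contains (fOne n S ++ gOne n T ++ fTwo n S) [4, 3, 1, 2] ↔ (S ∩ T).Nonempty) := by
  refine ⟨isPermOf_fOne_gOne_fTwo n S T, inter_nonempty_of_contains, ?_⟩
  rintro ⟨i, hi⟩
  obtain ⟨hiS, hiT⟩ := Finset.mem_inter.1 hi
  obtain ⟨h1, h2⟩ := Finset.mem_Icc.1 (hS hiS)
  exact contains_of_mem h1 h2 hiS hiT
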